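/- arXiv:1904.06305 — 5 statements merged into one kernel-verified Lean document; each statement's English description precedes it below -/
import Mathlib

section
/- Let d ≥ 1, let δ > 0, R > 0, and let ψ : [0,∞) → [0,∞) be continuous, strictly increasing with ψ(0) = 0. Then there exists a continuous, strictly increasing function τ : ψ([0,∞)) → [0,∞) with τ(0) = 0, depending only on d, δ, R, and ψ, such that for every matrix G ∈ ℝ^{d×d}, every vector b ∈ ℝ^d, and every measurable set E ⊆ B_R(0) with ℒ^d(E) ≥ δ, one has |G| + |b| ≤ τ( ⨍_E ψ(|Gx + b|) dx ). -/
open MeasureTheory Metric Set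

/-- The Frobenius norm of a real `d × d` matrix. -/
noncomputable def frobNorm {d : ℕ} (A : Matrix (Fin d) (Fin d) ℝ) : ℝ :=
  Real.sqrt (∑ i, ∑ j, (A i j) ^ 2)

/-- Matrix-vector multiplication `x ↦ G x`, regarded as a map on Euclidean space. -/
noncomputable def matVec {d : ℕ} (G : Matrix (Fin d) (Fin d) ℝ)
    (x : EuclideanSpace ℝ (Fin d)) : EuclideanSpace ℝ (Fin d) :=
  (WithLp.equiv 2 (Fin d → ℝ)).symm (G.mulVec (WithLp.equiv 2 (Fin d → ℝ) x))

/-- The average of `φ` over `[0, z]`, written as an integral over `[0, 1]`. -/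
noncomputable def scaledMean (φ : ℝ → ℝ) (z : ℝ) : ℝ :=
  ∫ u in (0 : ℝ)..1, φ (z * u)

lemma continuous_scaledMean {φ : ℝ → ℝ} (hc : Continuous φ) : Continuous (scaledMean φ) := by
  unfold scaledMean
  apply intervalIntegral.continuous_parametric_intervalIntegral_of_continuous'
  fun_prop

lemma strictMonoOn_scaledMean {φ : ℝ → ℝ} (hc : Continuous φ) (hm : StrictMonoOn φ (Ici 0)) :
    StrictMonoOn (scaledMean φ) (Ici 0) := by
  intro a ha b hb hab
  have ha' : (0 : ℝ) ≤ a := ha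
  have hb' : (0 : ℝ) ≤ b := hb
  refine intervalIntegral.integral_lt_integral_of_continuousOn_of_le_of_exists_lt one_pos
    (by fun_prop) (by fun_prop) (fun u hu => ?_) ⟨1, by simp, ?_⟩
  · exact hm.monotoneOn (mem_Ici.2 (mul_nonneg ha' hu.1.le)) (mem_Ici.2 (mul_nonneg hb' hu.1.le))
      (mul_le_mul_of_nonneg_right hab.le hu.1.le)
  · simpa using hm ha hb hab

lemma scaledMean_zero {φ : ℝ → ℝ} (h0 : φ 0 = 0) : scaledMean φ 0 = 0 := by
  simp [scaledMean, h0]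

lemma exists_lt_scaledMean {φ : ℝ → ℝ} (hc : Continuous φ) (hm : StrictMonoOn φ (Ici 0))
    (h0 : φ 0 = 0) {t : ℝ} (ht : 0 ≤ t) : ∃ z, 0 ≤ z ∧ φ t < scaledMean φ z := by
  have hpos : ∀ x, 0 ≤ x → 0 ≤ φ x := fun x hx => by
    rw [← h0]; exact hm.monotoneOn (mem_Ici.2 le_rfl) hx hx
  have hlt : φ t < φ (t + 1) := hm ht (mem_Ici.2 (by linarith)) (by linarith)
  have hp1 : 0 < φ (t + 1) := (hpos t ht).trans_lt hlt
  obtain ⟨θ, hθ1, hθ2⟩ : ∃ θ, max 0 (φ t / φ (t + 1)) < 1 - θ ∧ 0 < θ := by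
    have : max 0 (φ t / φ (t + 1)) < 1 := max_lt one_pos ((div_lt_one hp1).2 hlt)
    exact ⟨(1 - max 0 (φ t / φ (t + 1))) / 2, by linarith, by linarith⟩
  have hθ3 : θ < 1 := by linarith [le_max_left 0 (φ t / φ (t + 1))]
  have hθ4 : φ t < (1 - θ) * φ (t + 1) :=
    (div_lt_iff₀ hp1).1 ((le_max_right _ _).trans_lt hθ1)
  have hz : 0 ≤ (t + 1) / θ := by positivity
  refine ⟨(t + 1) / θ, hz, hθ4.trans_le ?_⟩
  have hi : ∀ a b, IntervalIntegrable (fun u => φ ((t + 1) / θ * u)) volume a b :=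
    fun a b => (by fun_prop : Continuous fun u => φ ((t + 1) / θ * u)).intervalIntegrable a b
  rw [scaledMean, ← intervalIntegral.integral_add_adjacent_intervals (hi 0 θ) (hi θ 1)]
  have h1 : 0 ≤ ∫ u in (0 : ℝ)..θ, φ ((t + 1) / θ * u) :=
    intervalIntegral.integral_nonneg hθ2.le fun u hu => hpos _ (mul_nonneg hz hu.1)
  have h2 : (1 - θ) * φ (t + 1) ≤ ∫ u in θ..1, φ ((t + 1) / θ * u) := by
    calc (1 - θ) * φ (t + 1) = ∫ _ in θ..1, φ (t + 1) := by simp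
      _ ≤ _ := by
        refine intervalIntegral.integral_mono_on hθ3.le (by simp) (hi θ 1) fun u hu => ?_
        have hu' : t + 1 ≤ (t + 1) / θ * u := by
          rw [div_mul_eq_mul_div, le_div_iff₀ hθ2]
          exact mul_le_mul_of_nonneg_left hu.1 (by linarith)
        exact hm.monotoneOn (mem_Ici.2 (by linarith)) (mem_Ici.2 (by linarith)) hu'
  linarith

/-- A continuous strictly increasing function on `[0, ∞)` has a continuous strictly increasing
inverse on its image. -/
lemma exists_strictMonoOn_inverse {Φ : ℝ → ℝ} (hc : ContinuousOn Φ (Ici 0))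
    (hm : StrictMonoOn Φ (Ici 0)) :
    ∃ σ : ℝ → ℝ, ContinuousOn σ (Φ '' Ici 0) ∧ StrictMonoOn σ (Φ '' Ici 0) ∧
      ∀ z, 0 ≤ z → σ (Φ z) = z := by
  have hinv : ∀ z, 0 ≤ z → Function.invFunOn Φ (Ici 0) (Φ z) = z := fun z hz =>
    hm.injOn.leftInvOn_invFunOn hz
  refine ⟨Function.invFunOn Φ (Ici 0), ?_, ?_, hinv⟩
  · have : OrdConnected (Φ '' Ici 0) := (isPreconnected_Ici.image Φ hc).ordConnected
    rw [continuousOn_iff_continuous_domRestrict]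
    have h := continuous_subtype_val.comp (hm.orderIso Φ (Ici 0)).symm.continuous
    convert h using 1
    ext ⟨y, z, hz, rfl⟩
    have : (hm.orderIso Φ (Ici 0)).symm ⟨Φ z, z, hz, rfl⟩ = ⟨z, hz⟩ := by
      rw [OrderIso.symm_apply_eq]; rfl
    simp [this, hinv z hz]
  · rintro _ ⟨a, ha, rfl⟩ _ ⟨b, hb, rfl⟩ hab
    rw [hinv a ha, hinv b hb]
    exact (hm.lt_iff_lt ha hb).1 hab

/-- If `f / z` stochastically dominates the uniform distribution on `[0, 1]`, then the mean of
`φ ∘ f` dominates the mean of `φ` on `[0, z]`. -/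
lemma scaledMean_le_average {α : Type*} [MeasurableSpace α] {μ : Measure α} [IsFiniteMeasure μ]
    (hμ : μ ≠ 0) {φ : ℝ → ℝ} (hc : Continuous φ) (hm : StrictMonoOn φ (Ici 0)) (h0 : φ 0 = 0)
    (hnn : ∀ t, 0 ≤ φ t) {f : α → ℝ} (hf : Measurable f) (hf0 : ∀ x, 0 ≤ f x)
    (hint : Integrable (fun x => φ (f x)) μ) {z : ℝ} (hz : 0 < z)
    (hdom : ∀ t, 0 < t → μ {x | f x ≤ t} ≤ μ univ * ENNReal.ofReal (t / z)) :
    scaledMean φ z ≤ ⨍ x, φ (f x) ∂μ := by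
  have key : μ univ * ∫⁻ u in Ioc (0 : ℝ) 1, ENNReal.ofReal (φ (z * u)) ≤
      ∫⁻ x, ENNReal.ofReal (φ (f x)) ∂μ := by
    rw [lintegral_eq_lintegral_meas_lt μ (.of_forall fun x => hnn _) hint.aemeasurable,
      lintegral_eq_lintegral_meas_lt (volume.restrict (Ioc (0 : ℝ) 1))
        (.of_forall fun x => hnn _) (by fun_prop),
      ← lintegral_const_mul' _ _ (measure_ne_top μ univ)]
    refine setLIntegral_mono' measurableSet_Ioi fun s hs => ?_
    have hs : 0 < s := hs
    by_cases hw : ∃ w, 0 ≤ w ∧ s < φ w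
    · obtain ⟨w, hw0, hw⟩ := hw
      obtain ⟨t, ht, rfl⟩ : s ∈ φ '' Icc 0 w :=
        intermediate_value_Icc hw0 hc.continuousOn ⟨by rw [h0]; exact hs.le, hw.le⟩
      have ht0 : 0 < t := ht.1.lt_of_ne (by rintro rfl; simp [h0] at hs)
      have hset : {x | φ t < φ (f x)} = {x | f x ≤ t}ᶜ := by
        ext x
        simp [hm.lt_iff_lt (mem_Ici.2 ht0.le) (mem_Ici.2 (hf0 x))]
      have hle : volume.restrict (Ioc (0 : ℝ) 1) {u | φ t < φ (z * u)} ≤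
          ENNReal.ofReal (1 - t / z) := by
        rw [Measure.restrict_apply (measurableSet_lt (by fun_prop) (by fun_prop)),
          ← Real.volume_Ioc]
        refine measure_mono ?_
        rintro u ⟨hu, hu0, hu1⟩
        refine ⟨?_, hu1⟩
        have := (hm.lt_iff_lt (mem_Ici.2 ht0.le) (mem_Ici.2 (by positivity))).1 hu
        rw [div_lt_iff₀ hz]; linarith
      refine (mul_le_mul_right hle _).trans ?_
      rw [hset]
      by_cases hp : 1 ≤ t / z
      · simp [ENNReal.ofReal_of_nonpos (sub_nonpos.2 hp)]
      have hp0 : 0 ≤ t / z := by positivity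
      refine (ENNReal.add_le_add_iff_right
        (ENNReal.mul_ne_top (measure_ne_top μ univ) (ENNReal.ofReal_ne_top (r := t / z)))).1 ?_
      rw [← mul_add, ← ENNReal.ofReal_add (by linarith) hp0, sub_add_cancel, ENNReal.ofReal_one,
        mul_one]
      calc μ univ = μ {x | f x ≤ t} + μ {x | f x ≤ t}ᶜ :=
            (measure_add_measure_compl (measurableSet_le hf measurable_const)).symm
        _ ≤ _ := by
          rw [add_comm]
          gcongr
          exact hdom t ht0
    · push Not at hw
      have : volume.restrict (Ioc (0 : ℝ) 1) {u | s < φ (z * u)} = 0 := by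
        rw [Measure.restrict_apply (measurableSet_lt (by fun_prop) (by fun_prop))]
        convert measure_empty (μ := volume)
        ext u
        simp only [mem_inter_iff, mem_ofPred_eq, mem_Ioc, mem_empty_iff_false, iff_false, not_and]
        intro h1 h2 _
        exact absurd (hw (z * u) (mul_nonneg hz.le h2.le)) (not_le.2 h1)
      simp [this]
  have hu : 0 < μ.real univ :=
    ENNReal.toReal_pos (by simpa using hμ) (measure_ne_top μ univ)
  have hI : IntegrableOn (fun u => φ (z * u)) (Ioc 0 1) :=
    (by fun_prop : Continuous fun u => φ (z * u)).integrableOn_Ioc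
  rw [← ofReal_integral_eq_lintegral_ofReal hint (.of_forall fun x => hnn _),
    ← ofReal_integral_eq_lintegral_ofReal hI (.of_forall fun x => hnn _),
    ← ofReal_measureReal (measure_ne_top μ univ), ← ENNReal.ofReal_mul hu.le,
    ENNReal.ofReal_le_ofReal_iff (integral_nonneg fun x => hnn _)] at key
  rw [average_eq, smul_eq_mul, scaledMean, intervalIntegral.integral_of_le zero_le_one,
    le_inv_mul_iff₀ hu]
  exact key

lemma matVec_apply {d : ℕ} (G : Matrix (Fin d) (Fin d) ℝ) (x : EuclideanSpace ℝ (Fin d))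
    (i : Fin d) : matVec G x i = ∑ j, G i j * x j := rfl

lemma matVec_add {d : ℕ} (G : Matrix (Fin d) (Fin d) ℝ) (x y : EuclideanSpace ℝ (Fin d)) :
    matVec G (x + y) = matVec G x + matVec G y := by
  ext i
  simp [matVec_apply, mul_add, Finset.sum_add_distrib]

lemma matVec_smul {d : ℕ} (G : Matrix (Fin d) (Fin d) ℝ) (c : ℝ) (x : EuclideanSpace ℝ (Fin d)) :
    matVec G (c • x) = c • matVec G x := by
  ext i
  simp [matVec_apply, Finset.mul_sum, mul_left_comm]

lemma continuous_matVec {d : ℕ} (G : Matrix (Fin d) (Fin d) ℝ) : Continuous (matVec G) :=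
  (IsLinearMap.mk' (matVec G) ⟨matVec_add G, matVec_smul G⟩).continuous_of_finiteDimensional

lemma frobNorm_nonneg {d : ℕ} (G : Matrix (Fin d) (Fin d) ℝ) : 0 ≤ frobNorm G :=
  Real.sqrt_nonneg _

lemma norm_matVec_le {d : ℕ} (G : Matrix (Fin d) (Fin d) ℝ) (x : EuclideanSpace ℝ (Fin d)) :
    ‖matVec G x‖ ≤ frobNorm G * ‖x‖ := by
  rw [EuclideanSpace.norm_eq, EuclideanSpace.norm_eq, frobNorm, ← Real.sqrt_mul (by positivity)]
  refine Real.sqrt_le_sqrt ?_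
  rw [Finset.sum_mul]
  refine Finset.sum_le_sum fun i _ => ?_
  simpa [matVec_apply] using Finset.sum_mul_sq_le_sq_mul_sq Finset.univ (G i) x

lemma frobNorm_le_of_column_le {d : ℕ} (G : Matrix (Fin d) (Fin d) ℝ) {a : ℝ} (ha : 0 ≤ a)
    (h : ∀ j, ‖matVec G (EuclideanSpace.single j 1)‖ ≤ a) : frobNorm G ≤ d * a := by
  have hcol : ∀ j, ‖matVec G (EuclideanSpace.single j 1)‖ ^ 2 = ∑ i, (G i j) ^ 2 := fun j => by
    simp [EuclideanSpace.norm_sq_eq, matVec_apply]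
  refine Real.sqrt_le_iff.2 ⟨by positivity, ?_⟩
  rw [Finset.sum_comm]
  calc ∑ j, ∑ i, (G i j) ^ 2 ≤ ∑ _j : Fin d, a ^ 2 := Finset.sum_le_sum fun j _ => by
        rw [← hcol]; exact pow_le_pow_left₀ (norm_nonneg _) (h j) 2
    _ = d * a ^ 2 := by simp
    _ ≤ (d * a) ^ 2 := by
        rw [mul_pow]
        refine mul_le_mul_of_nonneg_right ?_ (sq_nonneg a)
        exact_mod_cast Nat.le_self_pow two_ne_zero d

/-- If `G` stretches the unit vector `v` by more than `2 t / s`, the part of the ball where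
`‖G x + b‖ ≤ t` has small volume, since its translates by multiples of `s • v` are disjoint. -/
lemma volume_sublevel_le_of_stretch {d : ℕ} (G : Matrix (Fin d) (Fin d) ℝ)
    (b v : EuclideanSpace ℝ (Fin d)) (hv : ‖v‖ = 1) {R t s : ℝ} (hR : 0 < R) (hs : 0 < s)
    (hst : 2 * t < s * ‖matVec G v‖) :
    volume (ball (0 : EuclideanSpace ℝ (Fin d)) R ∩ {x | ‖matVec G x + b‖ ≤ t}) ≤
      ENNReal.ofReal (s / R) * volume (ball (0 : EuclideanSpace ℝ (Fin d)) (2 * R)) := by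
  set S := ball (0 : EuclideanSpace ℝ (Fin d)) R ∩ {x | ‖matVec G x + b‖ ≤ t} with hS
  have hSm : MeasurableSet S := measurableSet_ball.inter
    (measurableSet_le ((continuous_matVec G).add continuous_const).norm.measurable
      measurable_const)
  set n := ⌈R / s⌉₊ with hn
  let T : ℕ → Set (EuclideanSpace ℝ (Fin d)) := fun k => (fun x => ((k : ℝ) * s) • v + x) ⁻¹' S
  have hTv : ∀ k, volume (T k) = volume S := fun k => measure_preimage_add _ _ _
  have hTd : (↑(Finset.range n) : Set ℕ).PairwiseDisjoint T := by
    intro k _ l _ hkl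
    refine Set.disjoint_left.2 fun x hx hy => ?_
    have hx' : ‖matVec G (((k : ℝ) * s) • v + x) + b‖ ≤ t := hx.2
    have hy' : ‖matVec G (((l : ℝ) * s) • v + x) + b‖ ≤ t := hy.2
    rw [matVec_add, matVec_smul] at hx' hy'
    have h1 := norm_sub_le (((k : ℝ) * s) • matVec G v + matVec G x + b)
      (((l : ℝ) * s) • matVec G v + matVec G x + b)
    have h2 : ((k : ℝ) * s) • matVec G v + matVec G x + b -
      (((l : ℝ) * s) • matVec G v + matVec G x + b) = (((k : ℝ) - l) * s) • matVec G v := by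
      module
    rw [h2, norm_smul, norm_mul, Real.norm_of_nonneg hs.le] at h1
    have h3 : (1 : ℝ) ≤ ‖(k : ℝ) - l‖ := by
      rw [Real.norm_eq_abs]
      have : (1 : ℤ) ≤ |(k : ℤ) - l| := Int.one_le_abs (sub_ne_zero.2 (by exact_mod_cast hkl))
      exact_mod_cast this
    have h4 : s * ‖matVec G v‖ ≤ ‖(k : ℝ) - l‖ * s * ‖matVec G v‖ := by
      rw [mul_assoc]
      exact le_mul_of_one_le_left (by positivity) h3
    linarith
  have hTs : (⋃ k ∈ Finset.range n, T k) ⊆ ball 0 (2 * R) := by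
    refine iUnion₂_subset fun k hk x hx => ?_
    have hx' : ‖((k : ℝ) * s) • v + x‖ < R := mem_ball_zero_iff.1 hx.1
    have hk' : (k : ℝ) < R / s := Nat.lt_ceil.1 (Finset.mem_range.1 hk)
    rw [lt_div_iff₀ hs] at hk'
    have h1 := norm_sub_le (((k : ℝ) * s) • v + x) (((k : ℝ) * s) • v)
    rw [add_sub_cancel_left, norm_smul, hv, mul_one, Real.norm_of_nonneg (by positivity)] at h1
    rw [mem_ball_zero_iff]
    linarith
  have hle : (n : ENNReal) * volume S ≤ volume (ball (0 : EuclideanSpace ℝ (Fin d)) (2 * R)) := by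
    calc (n : ENNReal) * volume S = ∑ k ∈ Finset.range n, volume (T k) := by simp [hTv]
      _ = volume (⋃ k ∈ Finset.range n, T k) :=
        (measure_biUnion_finset hTd fun k _ => (measurable_const_add _) hSm).symm
      _ ≤ _ := measure_mono hTs
  have hn1 : (1 : ENNReal) ≤ ENNReal.ofReal (s / R) * n := by
    rw [← ENNReal.ofReal_natCast, ← ENNReal.ofReal_mul (by positivity), ENNReal.one_le_ofReal]
    calc (1 : ℝ) = s / R * (R / s) := by field_simp
      _ ≤ s / R * n := by gcongr; exact Nat.le_ceil _
  calc volume S ≤ (ENNReal.ofReal (s / R) * n) * volume S := le_mul_of_one_le_left' hn1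
    _ ≤ _ := by rw [mul_assoc]; gcongr

/-- Sublevel sets of affine maps in a ball have volume controlled linearly by the level. -/
lemma exists_volume_sublevel_le (d : ℕ) (hd : 1 ≤ d) {R : ℝ} (hR : 0 < R) :
    ∃ K : ℝ, 0 < K ∧ ∀ (G : Matrix (Fin d) (Fin d) ℝ) (b : EuclideanSpace ℝ (Fin d)) (t : ℝ),
      0 < t → 0 < frobNorm G + ‖b‖ →
      volume (ball (0 : EuclideanSpace ℝ (Fin d)) R ∩ {x | ‖matVec G x + b‖ ≤ t}) ≤
        ENNReal.ofReal (K * (t / (frobNorm G + ‖b‖))) := by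
  have hd' : (0 : ℝ) < d := by exact_mod_cast hd
  set V := (volume (ball (0 : EuclideanSpace ℝ (Fin d)) (2 * R))).toReal with hV
  have hVe : ENNReal.ofReal V = volume (ball (0 : EuclideanSpace ℝ (Fin d)) (2 * R)) :=
    ENNReal.ofReal_toReal measure_ball_lt_top.ne
  have hV0 : 0 < V :=
    ENNReal.toReal_pos (measure_ball_pos _ _ (by positivity)).ne' measure_ball_lt_top.ne
  set κ : ℝ := 1 / (2 * d * (1 + R)) with hκ
  have hκ0 : 0 < κ := by positivity
  refine ⟨3 / (κ * R) * V + 2 * V, by positivity, fun G b t ht hN => ?_⟩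
  set N := frobNorm G + ‖b‖ with hNdef
  by_cases hcol : ∀ j, ‖matVec G (EuclideanSpace.single j 1)‖ ≤ κ * N
  · have hG := frobNorm_le_of_column_le G (by positivity) hcol
    have hG' : frobNorm G * (1 + R) ≤ N / 2 := by
      calc frobNorm G * (1 + R) ≤ d * (κ * N) * (1 + R) := by gcongr
        _ = N / 2 := by rw [hκ]; field_simp
    by_cases htN : t < N / 2
    · convert zero_le (a := ENNReal.ofReal ((3 / (κ * R) * V + 2 * V) * (t / N)))
      convert measure_empty (μ := volume)
      ext x
      simp only [mem_inter_iff, mem_ball_zero_iff, mem_ofPred_eq, mem_empty_iff_false, iff_false,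
        not_and, not_le]
      intro hx
      have h1 := norm_matVec_le G x
      have h2 : frobNorm G * ‖x‖ ≤ frobNorm G * R :=
        mul_le_mul_of_nonneg_left hx.le (frobNorm_nonneg G)
      have h3 := norm_sub_le (matVec G x + b) (matVec G x)
      rw [add_sub_cancel_left] at h3
      nlinarith
    · calc _ ≤ volume (ball (0 : EuclideanSpace ℝ (Fin d)) (2 * R)) :=
          measure_mono (inter_subset_left.trans (ball_subset_ball (by linarith)))
        _ = ENNReal.ofReal V := hVe.symm
        _ ≤ _ := by
          refine ENNReal.ofReal_le_ofReal ?_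
          have h1 : 1 / 2 ≤ t / N := by rw [le_div_iff₀ hN]; linarith
          have h2 : 0 ≤ 3 / (κ * R) * V := by positivity
          nlinarith
  · push Not at hcol
    obtain ⟨j, hj⟩ := hcol
    have hs : 0 < 3 * t / (κ * N) := by positivity
    refine (volume_sublevel_le_of_stretch G b (EuclideanSpace.single j 1) (by simp) hR hs
      (t := t) ?_).trans ?_
    · calc 2 * t < 3 * t / (κ * N) * (κ * N) := by field_simp; linarith
        _ ≤ _ := by gcongr
    · rw [← hVe, ← ENNReal.ofReal_mul (by positivity)]
      refine ENNReal.ofReal_le_ofReal ?_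
      have : 3 * t / (κ * N) / R * V = 3 / (κ * R) * V * (t / N) := by field_simp
      rw [this, add_mul]
      have : 0 ≤ 2 * V * (t / N) := by positivity
      linarith

/-- Lemma 3.2 (first part): for `d ≥ 1`, `δ > 0`, `R > 0`, and a continuous,
strictly increasing `ψ : [0,∞) → [0,∞)` with `ψ(0) = 0`, there is a continuous,
strictly increasing `τ : ψ([0,∞)) → [0,∞)` with `τ(0) = 0`, depending only on
`d`, `δ`, `R`, `ψ`, such that for every `G ∈ ℝ^{d×d}`, `b ∈ ℝ^d`, and every
measurable `E ⊆ B_R(0)` with `ℒ^d(E) ≥ δ`, one has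
`|G| + |b| ≤ τ(⨍_E ψ(|Gx + b|) dx)`. -/
theorem rigid_motion_control
    (d : ℕ) (hd : 1 ≤ d) (δ R : ℝ) (hδ : 0 < δ) (hR : 0 < R)
    (ψ : ℝ → ℝ) (hψc : ContinuousOn ψ (Ici 0))
    (hψm : StrictMonoOn ψ (Ici 0))
    (hψ0 : ψ 0 = 0) (hψnn : ∀ t ∈ Ici (0 : ℝ), 0 ≤ ψ t) :
    ∃ τ : ℝ → ℝ,
      ContinuousOn τ (ψ '' Ici 0) ∧ StrictMonoOn τ (ψ '' Ici 0) ∧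
      (∀ t ∈ ψ '' Ici 0, 0 ≤ τ t) ∧ τ 0 = 0 ∧
      ∀ (G : Matrix (Fin d) (Fin d) ℝ) (b : EuclideanSpace ℝ (Fin d))
        (E : Set (EuclideanSpace ℝ (Fin d))),
        MeasurableSet E → E ⊆ ball (0 : EuclideanSpace ℝ (Fin d)) R →
        ENNReal.ofReal δ ≤ volume E →
        frobNorm G + ‖b‖ ≤ τ (⨍ x in E, ψ ‖matVec G x + b‖) := by
  obtain ⟨K, hK, hvol⟩ := exists_volume_sublevel_le d hd hR
  set φ : ℝ → ℝ := fun t => ψ (max t 0) with hφ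
  have hφψ : ∀ t, 0 ≤ t → φ t = ψ t := fun t ht => by simp [hφ, ht]
  have hφc : Continuous φ := hψc.comp_continuous (by fun_prop) fun t => le_max_right t 0
  have hφm : StrictMonoOn φ (Ici 0) := hψm.congr fun t ht => (hφψ t ht).symm
  have hφ0 : φ 0 = 0 := by simp [hφ, hψ0]
  have hφnn : ∀ t, 0 ≤ φ t := fun t => hψnn _ (le_max_right t 0)
  have hΦc := continuous_scaledMean hφc
  have hΦm := strictMonoOn_scaledMean hφc hφm
  obtain ⟨σ, hσc, hσm, hσ⟩ := exists_strictMonoOn_inverse hΦc.continuousOn hΦm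
  have hsub : ψ '' Ici 0 ⊆ scaledMean φ '' Ici 0 := by
    rintro _ ⟨t, ht, rfl⟩
    obtain ⟨z, hz, hlt⟩ := exists_lt_scaledMean hφc hφm hφ0 ht
    rw [hφψ t ht] at hlt
    refine image_mono Icc_subset_Ici_self
      (intermediate_value_Icc hz hΦc.continuousOn ⟨?_, hlt.le⟩)
    rw [scaledMean_zero hφ0]
    exact hψnn t ht
  have hKδ : 0 < K / δ := by positivity
  refine ⟨fun s => K / δ * σ s, (hσc.mono hsub).const_mul _,
    fun a ha b hb hab => mul_lt_mul_of_pos_left (hσm (hsub ha) (hsub hb) hab) hKδ,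
    fun s hs => ?_, ?_, fun G b E hE hER hEδ => ?_⟩
  · obtain ⟨z, hz, rfl⟩ := hsub hs
    have hz : 0 ≤ z := hz
    simp only [hσ z hz]
    positivity
  · have := hσ 0 le_rfl
    rw [scaledMean_zero hφ0] at this
    simp [this]
  set f : EuclideanSpace ℝ (Fin d) → ℝ := fun x => ‖matVec G x + b‖ with hf
  have hfc : Continuous f := ((continuous_matVec G).add continuous_const).norm
  have hf0 : ∀ x, 0 ≤ f x := fun x => norm_nonneg _
  have hE0 : volume E ≠ 0 := ((ENNReal.ofReal_pos.2 hδ).trans_le hEδ).ne'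
  have hEtop : volume E ≠ ⊤ := measure_ne_top_of_subset hER measure_ball_lt_top.ne
  have : IsFiniteMeasure (volume.restrict E) := ⟨by simpa using hEtop.lt_top⟩
  have hμ : volume.restrict E ≠ 0 := by simpa using hE0
  set W := frobNorm G * R + ‖b‖ with hW
  have hfW : ∀ x ∈ E, f x ≤ W := fun x hx => by
    have h1 := norm_matVec_le G x
    have h2 : frobNorm G * ‖x‖ ≤ frobNorm G * R :=
      mul_le_mul_of_nonneg_left (mem_ball_zero_iff.1 (hER hx)).le (frobNorm_nonneg G)
    have h3 := norm_add_le (matVec G x) b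
    simp only [hf]
    linarith
  have hW0 : 0 ≤ W := by have := frobNorm_nonneg G; positivity
  have hbd : ∀ x ∈ E, φ (f x) ≤ φ W := fun x hx => hφm.monotoneOn (hf0 x) hW0 (hfW x hx)
  have hint : Integrable (fun x => φ (f x)) (volume.restrict E) :=
    Measure.integrableOn_of_bounded (M := φ W) hEtop
      (hφc.comp hfc).aestronglyMeasurable ((ae_restrict_iff' hE).2 (.of_forall fun x hx => by
        rw [Real.norm_of_nonneg (hφnn _)]; exact hbd x hx))
  have hψφ : (⨍ x in E, ψ ‖matVec G x + b‖) = ⨍ x in E, φ (f x) := by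
    simp only [hf, hφψ _ (norm_nonneg _)]
  have havg0 : 0 ≤ ⨍ x in E, φ (f x) := by
    rw [average_eq]
    exact smul_nonneg (by positivity) (integral_nonneg fun x => hφnn _)
  have havgW : (⨍ x in E, φ (f x)) ≤ φ W := by
    obtain ⟨x, hx, hle⟩ := exists_setAverage_le hE0 hEtop hint
    exact hle.trans (hbd x hx)
  have hmem : (⨍ x in E, φ (f x)) ∈ ψ '' Ici 0 := by
    refine image_mono Icc_subset_Ici_self (intermediate_value_Icc hW0
      (hψc.mono Icc_subset_Ici_self) ⟨?_, ?_⟩)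
    · rwa [hψ0]
    · rwa [← hφψ W hW0]
  rw [hψφ]
  set N := frobNorm G + ‖b‖ with hN
  have hN0 : 0 ≤ N := by have := frobNorm_nonneg G; positivity
  have hmain : scaledMean φ (δ / K * N) ≤ ⨍ x in E, φ (f x) := by
    rcases hN0.eq_or_lt with h | hNpos
    · rw [← h, mul_zero, scaledMean_zero hφ0]
      exact havg0
    refine scaledMean_le_average hμ hφc hφm hφ0 hφnn hfc.measurable hf0 hint (by positivity)
      fun t ht => ?_
    rw [Measure.restrict_apply (measurableSet_le hfc.measurable measurable_const),
      Measure.restrict_apply_univ]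
    calc volume ({x | f x ≤ t} ∩ E)
        ≤ volume (ball (0 : EuclideanSpace ℝ (Fin d)) R ∩ {x | ‖matVec G x + b‖ ≤ t}) :=
          measure_mono fun x hx => ⟨hER hx.2, hx.1⟩
      _ ≤ ENNReal.ofReal (K * (t / N)) := hvol G b t ht hNpos
      _ = ENNReal.ofReal δ * ENNReal.ofReal (t / (δ / K * N)) := by
          rw [← ENNReal.ofReal_mul hδ.le]
          congr 1
          field_simp
      _ ≤ _ := by gcongr
  obtain ⟨z, hz, hzeq⟩ := hsub hmem
  have hz : 0 ≤ z := hz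
  rw [← hzeq] at hmain ⊢
  have hle := (hΦm.le_iff_le (mem_Ici.2 (by positivity : 0 ≤ δ / K * N)) hz).1 hmain
  simp only [hσ z hz]
  calc N = K / δ * (δ / K * N) := by field_simp
    _ ≤ K / δ * z := by gcongr
end

section
/- Let d ≥ 1, δ > 0, R > 0 and p ∈ [1,∞). Then there exists a constant c > 0, depending only on d, p, δ, and R, such that for every matrix G ∈ ℝ^{d×d}, every vector b ∈ ℝ^d, and every measurable set E ⊆ B_R(0) with ℒ^d(E) ≥ δ, one has |G| + |b| ≤ c ( ⨍_E |Gx + b|^p dx )^{1/p}. -/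
open MeasureTheory Metric Set

section AffineSublevel

variable {V : Type*} [NormedAddCommGroup V] [NormedSpace ℝ V] [FiniteDimensional ℝ V]
  [MeasurableSpace V] [BorelSpace V]

/-- The zero set of a nontrivial affine map is a null set. -/
lemma addHaar_affine_zeroSet (μ : Measure V) [μ.IsAddHaarMeasure] {v : (V →L[ℝ] V) × V}
    (hv : v ≠ 0) : μ {x | v.1 x + v.2 = 0} = 0 := by
  rcases Set.eq_empty_or_nonempty {x | v.1 x + v.2 = 0} with h | ⟨x₀, hx₀⟩
  · simp [h]
  have hx₀' : v.1 x₀ + v.2 = 0 := hx₀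
  have hker : (v.1 : V →ₗ[ℝ] V).ker ≠ ⊤ := by
    intro h
    have h1 : v.1 = 0 := by
      ext x
      have : x ∈ (v.1 : V →ₗ[ℝ] V).ker := by rw [h]; trivial
      simpa using this
    exact hv (Prod.ext h1 (by simpa [h1] using hx₀'))
  have hset : {x | v.1 x + v.2 = 0} =
      (fun x => x + -x₀) ⁻¹' ((v.1 : V →ₗ[ℝ] V).ker : Set V) := by
    ext x
    simp only [mem_ofPred_eq, mem_preimage, SetLike.mem_coe, LinearMap.mem_ker,
      ContinuousLinearMap.coe_coe, map_add, map_neg]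
    rw [eq_neg_of_add_eq_zero_left hx₀', neg_neg]
  rw [hset, measure_preimage_add_right]
  exact Measure.addHaar_submodule μ _ hker

lemma exists_addHaar_sublevel_lt (μ : Measure V) [μ.IsAddHaarMeasure] (R : ℝ) {η : ENNReal}
    (hη : 0 < η) {v : (V →L[ℝ] V) × V} (hv : v ≠ 0) :
    ∃ ε > 0, μ (ball 0 R ∩ {x | ‖v.1 x + v.2‖ ≤ ε}) < η := by
  have hlim : Filter.Tendsto (fun ε : ℝ => μ (ball 0 R ∩ {x | ‖v.1 x + v.2‖ ≤ ε}))
      (nhdsWithin 0 (Ioi 0))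
      (nhds (μ (⋂ ε > (0 : ℝ), ball 0 R ∩ {x | ‖v.1 x + v.2‖ ≤ ε}))) := by
    refine tendsto_measure_biInter_gt (fun ε _ => ?_) (fun i j _ hij => ?_) ⟨1, one_pos, ?_⟩
    · have : IsClosed {x | ‖v.1 x + v.2‖ ≤ ε} := isClosed_le (by fun_prop) continuous_const
      exact (measurableSet_ball.inter this.measurableSet).nullMeasurableSet
    · exact inter_subset_inter_right _ fun x hx => le_trans hx hij
    · exact ((measure_mono inter_subset_left).trans_lt measure_ball_lt_top).ne
  have hzero : μ (⋂ ε > (0 : ℝ), ball 0 R ∩ {x | ‖v.1 x + v.2‖ ≤ ε}) = 0 := by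
    refine measure_mono_null (fun x hx => ?_) (addHaar_affine_zeroSet μ hv)
    simp only [mem_iInter] at hx
    have : ‖v.1 x + v.2‖ ≤ 0 := le_of_forall_gt_imp_ge_of_dense fun ε hε => (hx ε hε).2
    exact norm_le_zero_iff.1 this
  rw [hzero] at hlim
  obtain ⟨ε, h, hε⟩ := ((hlim.eventually_lt_const hη).and self_mem_nhdsWithin).exists
  exact ⟨ε, hε, h⟩

lemma exists_addHaar_sublevel_lt_of_mem_sphere (μ : Measure V) [μ.IsAddHaarMeasure] {R : ℝ}
    (hR : 0 < R) {η : ENNReal} (hη : 0 < η) :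
    ∃ ε > 0, ∀ v ∈ sphere (0 : (V →L[ℝ] V) × V) 1,
      μ (ball 0 R ∩ {x | ‖v.1 x + v.2‖ ≤ ε}) < η := by
  refine (isCompact_sphere (0 : (V →L[ℝ] V) × V) 1).induction_on
    (p := fun S => ∃ ε > 0, ∀ v ∈ S, μ (ball 0 R ∩ {x | ‖v.1 x + v.2‖ ≤ ε}) < η)
    ⟨1, one_pos, by simp⟩ ?_ ?_ ?_
  · rintro S T hST ⟨ε, hε, h⟩
    exact ⟨ε, hε, fun v hv => h v (hST hv)⟩
  · rintro S T ⟨ε, hε, h⟩ ⟨ε', hε', h'⟩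
    refine ⟨min ε ε', lt_min hε hε', fun v hv => ?_⟩
    rcases hv with hv | hv
    · refine (measure_mono (inter_subset_inter_right _ fun x hx => ?_)).trans_lt (h v hv)
      exact le_trans (show ‖v.1 x + v.2‖ ≤ min ε ε' from hx) (min_le_left _ _)
    · refine (measure_mono (inter_subset_inter_right _ fun x hx => ?_)).trans_lt (h' v hv)
      exact le_trans (show ‖v.1 x + v.2‖ ≤ min ε ε' from hx) (min_le_right _ _)
  · intro v hv
    obtain ⟨ε, hε, h⟩ := exists_addHaar_sublevel_lt μ R hη (ne_zero_of_mem_unit_sphere ⟨v, hv⟩)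
    refine ⟨ball v (ε / 2 / (R + 1)),
      mem_nhdsWithin_of_mem_nhds (ball_mem_nhds v (by positivity)), ε / 2, by positivity,
      fun w hw => (measure_mono ?_).trans_lt h⟩
    rintro x ⟨hxR, hx⟩
    refine ⟨hxR, ?_⟩
    have hxR' : ‖x‖ ≤ R := by simpa using (mem_ball_zero_iff.1 hxR).le
    have hwv : ‖v - w‖ * (R + 1) ≤ ε / 2 := by
      rw [mem_ball, dist_comm, dist_eq_norm, lt_div_iff₀ (by positivity)] at hw
      exact hw.le
    have h1 : ‖(v - w).1 x‖ ≤ ‖v - w‖ * R :=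
      ((v - w).1.le_opNorm x).trans
        (mul_le_mul (norm_fst_le _) hxR' (norm_nonneg _) (norm_nonneg _))
    have h2 : ‖(v - w).2‖ ≤ ‖v - w‖ := norm_snd_le _
    have h3 : v.1 x + v.2 = (w.1 x + w.2) + ((v - w).1 x + (v - w).2) := by
      simp only [Prod.fst_sub, Prod.snd_sub, sub_apply]
      abel
    have hx' : ‖w.1 x + w.2‖ ≤ ε / 2 := hx
    change ‖v.1 x + v.2‖ ≤ ε
    rw [h3]
    linarith [norm_add_le (w.1 x + w.2) ((v - w).1 x + (v - w).2),
      norm_add_le ((v - w).1 x) (v - w).2]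

/-- Affine maps are quantitatively bounded below outside a small set, uniformly in the map. -/
lemma exists_addHaar_sublevel_mul_norm_lt (μ : Measure V) [μ.IsAddHaarMeasure] {R : ℝ}
    (hR : 0 < R) {η : ENNReal} (hη : 0 < η) :
    ∃ ε > 0, ∀ v : (V →L[ℝ] V) × V, v ≠ 0 →
      μ (ball 0 R ∩ {x | ‖v.1 x + v.2‖ ≤ ε * ‖v‖}) < η := by
  obtain ⟨ε, hε, h⟩ := exists_addHaar_sublevel_lt_of_mem_sphere μ hR hη
  refine ⟨ε, hε, fun v hv => ?_⟩
  have hv' : 0 < ‖v‖ := norm_pos_iff.2 hv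
  refine (measure_mono (inter_subset_inter_right _ fun x hx => ?_)).trans_lt
    (h (‖v‖⁻¹ • v) (by simp [norm_smul, hv'.ne']))
  have hx' : ‖v.1 x + v.2‖ ≤ ε * ‖v‖ := hx
  simp only [mem_ofPred_eq, Prod.smul_fst, Prod.smul_snd, smul_apply]
  rw [← smul_add, norm_smul, norm_inv, norm_norm, inv_mul_le_iff₀ hv', mul_comm]
  exact hx'

/-- An affine map is controlled by its `L^p` mean over any bounded set of measure at least `δ`. -/
lemma exists_norm_le_mul_setAverage_affine_rpow (μ : Measure V) [μ.IsAddHaarMeasure] {δ R p : ℝ}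
    (hδ : 0 < δ) (hR : 0 < R) (hp : 1 ≤ p) :
    ∃ c : ℝ, 0 < c ∧ ∀ (v : (V →L[ℝ] V) × V) (E : Set V),
      MeasurableSet E → E ⊆ ball 0 R → ENNReal.ofReal δ ≤ μ E →
        ‖v‖ ≤ c * (⨍ x in E, ‖v.1 x + v.2‖ ^ p ∂μ) ^ (1 / p) := by
  have hp0 : 0 < p := one_pos.trans_le hp
  obtain ⟨ε, hε, h⟩ := exists_addHaar_sublevel_mul_norm_lt μ hR
    (ENNReal.ofReal_pos.2 (half_pos hδ))
  refine ⟨2 / ε, by positivity, fun v E hE hER hEδ => ?_⟩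
  have havg : 0 ≤ ⨍ x in E, ‖v.1 x + v.2‖ ^ p ∂μ := by
    rw [setAverage_eq, smul_eq_mul]
    exact mul_nonneg (by positivity) (integral_nonneg fun x => by positivity)
  rcases eq_or_ne v 0 with rfl | hv
  · rw [norm_zero]; positivity
  have hv' : 0 < ‖v‖ := norm_pos_iff.2 hv
  have hEtop : μ E ≠ ⊤ := ((measure_mono hER).trans_lt measure_ball_lt_top).ne
  have hEδ' : δ ≤ μ.real E := (ENNReal.ofReal_le_iff_le_toReal hEtop).1 hEδ
  have hEpos : 0 < μ.real E := hδ.trans_le hEδ'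
  have hcont : Continuous fun x => ‖v.1 x + v.2‖ ^ p :=
    Continuous.rpow_const (by fun_prop) fun _ => Or.inr hp0.le
  have hint : IntegrableOn (fun x => ‖v.1 x + v.2‖ ^ p) E μ :=
    (hcont.continuousOn.integrableOn_compact (isCompact_closedBall (0 : V) R)).mono_set
      (hER.trans ball_subset_closedBall)
  have hmarkov := mul_meas_ge_le_integral_of_nonneg
    (Filter.Eventually.of_forall fun x => by positivity) hint ((ε * ‖v‖) ^ p)
  have hsmall : μ.real (ball 0 R ∩ {x | ‖v.1 x + v.2‖ ≤ ε * ‖v‖}) ≤ δ / 2 :=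
    ENNReal.toReal_le_of_le_ofReal (half_pos hδ).le (h v hv).le
  have hlarge : μ.real E / 2 ≤
      (μ.restrict E).real {x | (ε * ‖v‖) ^ p ≤ ‖v.1 x + v.2‖ ^ p} := by
    rw [measureReal_restrict_apply (measurableSet_le measurable_const hcont.measurable)]
    have hcover : E ⊆ (ball 0 R ∩ {x | ‖v.1 x + v.2‖ ≤ ε * ‖v‖}) ∪
        ({x | (ε * ‖v‖) ^ p ≤ ‖v.1 x + v.2‖ ^ p} ∩ E) := by
      intro x hx
      rcases le_total ‖v.1 x + v.2‖ (ε * ‖v‖) with hle | hle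
      · exact Or.inl ⟨hER hx, hle⟩
      · exact Or.inr ⟨Real.rpow_le_rpow (by positivity) hle hp0.le, hx⟩
    have hfin : μ ((ball 0 R ∩ {x | ‖v.1 x + v.2‖ ≤ ε * ‖v‖}) ∪
        ({x | (ε * ‖v‖) ^ p ≤ ‖v.1 x + v.2‖ ^ p} ∩ E)) ≠ ⊤ :=
      ((measure_mono (union_subset inter_subset_left
        (inter_subset_right.trans hER))).trans_lt measure_ball_lt_top).ne
    linarith [measureReal_mono hcover hfin, measureReal_union_le (μ := μ)
      (ball 0 R ∩ {x | ‖v.1 x + v.2‖ ≤ ε * ‖v‖})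
      ({x | (ε * ‖v‖) ^ p ≤ ‖v.1 x + v.2‖ ^ p} ∩ E)]
  have hmean : (ε * ‖v‖) ^ p * (1 / 2) ≤ ⨍ x in E, ‖v.1 x + v.2‖ ^ p ∂μ := by
    rw [setAverage_eq, smul_eq_mul, inv_mul_eq_div, le_div_iff₀ hEpos]
    refine le_trans (le_of_eq ?_) ((mul_le_mul_of_nonneg_left hlarge
      (by positivity : 0 ≤ (ε * ‖v‖) ^ p)).trans hmarkov)
    ring
  have hhalf : (1 / 2 : ℝ) ^ p ≤ 1 / 2 :=
    Real.rpow_le_self_of_le_one (by norm_num) (by norm_num) hp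
  have hroot : ε * ‖v‖ * (1 / 2) ≤ (⨍ x in E, ‖v.1 x + v.2‖ ^ p ∂μ) ^ (1 / p) := by
    rw [one_div p, Real.le_rpow_inv_iff_of_pos (by positivity) havg hp0,
      Real.mul_rpow (by positivity) (by norm_num)]
    exact (mul_le_mul_of_nonneg_left hhalf (by positivity)).trans hmean
  calc ‖v‖ = 2 / ε * (ε * ‖v‖ * (1 / 2)) := by field_simp
    _ ≤ _ := mul_le_mul_of_nonneg_left hroot (by positivity)

end AffineSublevel

lemma matVec_eq_toEuclideanCLM {d : ℕ} (G : Matrix (Fin d) (Fin d) ℝ)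
    (x : EuclideanSpace ℝ (Fin d)) : matVec G x = Matrix.toEuclideanCLM (𝕜 := ℝ) G x :=
  rfl

lemma frobNorm_le_mul_norm_toEuclideanCLM {d : ℕ} (G : Matrix (Fin d) (Fin d) ℝ) :
    frobNorm G ≤ d * ‖Matrix.toEuclideanCLM (𝕜 := ℝ) G‖ := by
  set T := Matrix.toEuclideanCLM (𝕜 := ℝ) G with hT
  have hentry (i j : Fin d) : G i j ^ 2 ≤ ‖T‖ ^ 2 := by
    have h1 : G i j = T (EuclideanSpace.single j 1) i := by
      simp [hT, Matrix.ofLp_toEuclideanCLM]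
    have h2 : |G i j| ≤ ‖T‖ := by
      rw [h1, ← Real.norm_eq_abs]
      refine (PiLp.norm_apply_le _ i).trans ((T.le_opNorm _).trans ?_)
      simp
    exact sq_le_sq' (abs_le.1 h2).1 (abs_le.1 h2).2
  refine Real.sqrt_le_iff.2 ⟨by positivity, ?_⟩
  calc ∑ i, ∑ j, G i j ^ 2 ≤ ∑ _i : Fin d, ∑ _j : Fin d, ‖T‖ ^ 2 :=
        Finset.sum_le_sum fun i _ => Finset.sum_le_sum fun j _ => hentry i j
    _ = (d * ‖T‖) ^ 2 := by simp; ring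


/-- Lemma 3.2 for `ψ(t) = t^p`: for `d ≥ 1`, `δ > 0`, `R > 0`, `p ∈ [1,∞)`,
there is a constant `c > 0`, depending only on `d`, `p`, `δ`, `R`, such that
for every `G ∈ ℝ^{d×d}`, `b ∈ ℝ^d`, and every measurable `E ⊆ B_R(0)` with
`ℒ^d(E) ≥ δ`, one has `|G| + |b| ≤ c (⨍_E |Gx + b|^p dx)^{1/p}`. -/
theorem rigid_motion_control_pow
    (d : ℕ) (hd : 1 ≤ d) (δ R p : ℝ) (hδ : 0 < δ) (hR : 0 < R) (hp : 1 ≤ p) :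
    ∃ c : ℝ, 0 < c ∧
      ∀ (G : Matrix (Fin d) (Fin d) ℝ) (b : EuclideanSpace ℝ (Fin d))
        (E : Set (EuclideanSpace ℝ (Fin d))),
        MeasurableSet E → E ⊆ ball (0 : EuclideanSpace ℝ (Fin d)) R →
        ENNReal.ofReal δ ≤ volume E →
        frobNorm G + ‖b‖ ≤ c * (⨍ x in E, ‖matVec G x + b‖ ^ p) ^ (1 / p) := by
  obtain ⟨c, hc, h⟩ := exists_norm_le_mul_setAverage_affine_rpow
    (volume : Measure (EuclideanSpace ℝ (Fin d))) hδ hR hp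
  refine ⟨(d + 1) * c, by positivity, fun G b E hE hER hEδ => ?_⟩
  set v := (Matrix.toEuclideanCLM (𝕜 := ℝ) G, b)
  have hG : frobNorm G ≤ d * ‖v‖ := (frobNorm_le_mul_norm_toEuclideanCLM G).trans
    (mul_le_mul_of_nonneg_left (norm_fst_le v) (by positivity))
  have hb : ‖b‖ ≤ ‖v‖ := norm_snd_le v
  simp only [matVec_eq_toEuclideanCLM]
  calc frobNorm G + ‖b‖ ≤ (d + 1) * ‖v‖ := by linarith
    _ ≤ (d + 1) * (c * (⨍ x in E, ‖v.1 x + v.2‖ ^ p) ^ (1 / p)) :=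
        mul_le_mul_of_nonneg_left (h v E hE hER hEδ) (by positivity)
    _ = _ := by rw [mul_assoc]
end

section
/- Let m, N ∈ ℕ with N ≥ 1 and let r₀ > 0. Then every set of points {x₁, …, x_N} ⊆ ℝ^m can be covered by finitely many pairwise disjoint open balls B_{r₁}(y₁), …, B_{r_M}(y_M) with M ≤ N and centers y₁, …, y_M ∈ ℝ^m, such that r_k ∈ [8^{−N} r₀, r₀] for every k = 1, …, M, and dist(B_{r_i}(y_i), B_{r_j}(y_j)) > 2 · max_{k=1,…,M} r_k for all 1 ≤ i < j ≤ M. -/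
open Metric Set

/-- If the balls of radius `r` centred at a finite set `s` cover `A`, then so do the balls of some
radius `R ∈ [r, 8 ^ #s * r]` centred at a subset of `s` whose points are more than `4 * R` apart. -/
theorem exists_subset_separated_cover {X : Type*} [PseudoMetricSpace X] (A : Set X)
    (s : Finset X) (hs : s.Nonempty) (r : ℝ) (hr : 0 < r)
    (hA : ∀ a ∈ A, ∃ p ∈ s, a ∈ ball p r) :
    ∃ t ⊆ s, t.Nonempty ∧ ∃ R, r ≤ R ∧ R ≤ 8 ^ s.card * r ∧
      (∀ a ∈ A, ∃ p ∈ t, a ∈ ball p R) ∧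
      ∀ p ∈ t, ∀ q ∈ t, p ≠ q → 4 * R < dist p q := by
  classical
  induction s using Finset.strongInduction generalizing r with
  | H s ih =>
    by_cases h : ∀ p ∈ s, ∀ q ∈ s, p ≠ q → 4 * r < dist p q
    · exact ⟨s, subset_rfl, hs, r, le_rfl,
        le_mul_of_one_le_left hr.le (one_le_pow₀ (by norm_num)), hA, h⟩
    · push Not at h
      obtain ⟨p, hp, q, hq, hpq, hd⟩ := h
      have hq' : q ∈ s.erase p := Finset.mem_erase.2 ⟨hpq.symm, hq⟩
      obtain ⟨t, hts, ht, R, hrR, hR, hcov, hsep⟩ :=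
        ih _ (Finset.erase_ssubset hp) ⟨q, hq'⟩ (8 * r) (by positivity) (by
          intro a ha
          obtain ⟨c, hc, hac⟩ := hA a ha
          rw [mem_ball] at hac
          by_cases hcp : c = p
          · subst hcp
            refine ⟨q, hq', mem_ball.2 ?_⟩
            linarith [dist_triangle a c q]
          · exact ⟨c, Finset.mem_erase.2 ⟨hcp, hc⟩, mem_ball.2 (by linarith)⟩)
      refine ⟨t, hts.trans (Finset.erase_subset _ _), ht, R, by linarith, ?_, hcov, hsep⟩
      rwa [← Finset.card_erase_add_one hp, pow_succ, mul_assoc]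

/-- Lemma 4.4 (covering with balls): every set of `N ≥ 1` points in `ℝ^m` can
be covered by at most `N` pairwise disjoint open balls whose radii lie in
`[8^{-N} r₀, r₀]` and whose mutual distances exceed twice the maximal radius. -/
theorem covering_with_balls
    (m N : ℕ) (hN : 1 ≤ N) (r₀ : ℝ) (hr₀ : 0 < r₀)
    (x : Fin N → EuclideanSpace ℝ (Fin m)) :
    ∃ (M : ℕ) (y : Fin M → EuclideanSpace ℝ (Fin m)) (rad : Fin M → ℝ),
      1 ≤ M ∧ M ≤ N ∧
      (∀ k, rad k ∈ Icc (r₀ / 8 ^ N) r₀) ∧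
      (∀ i j, i ≠ j → Disjoint (ball (y i) (rad i)) (ball (y j) (rad j))) ∧
      (∀ n, ∃ k, x n ∈ ball (y k) (rad k)) ∧
      (∀ i j, i ≠ j → ∀ k, 2 * rad k < dist (y i) (y j) - rad i - rad j) := by
  classical
  have hr : 0 < r₀ / 8 ^ N := by positivity
  have hcard : (Finset.univ.image x).card ≤ N := Finset.card_image_le.trans (by simp)
  obtain ⟨t, hts, ht, R, hrR, hR, hcov, hsep⟩ :=
    exists_subset_separated_cover (range x) (Finset.univ.image x)
      ⟨x ⟨0, hN⟩, Finset.mem_image_of_mem x (Finset.mem_univ _)⟩ _ hr (by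
        rintro _ ⟨n, rfl⟩
        exact ⟨x n, Finset.mem_image_of_mem x (Finset.mem_univ n), mem_ball_self hr⟩)
  have hR₀ : R ≤ r₀ := calc
    R ≤ 8 ^ (Finset.univ.image x).card * (r₀ / 8 ^ N) := hR
    _ ≤ 8 ^ N * (r₀ / 8 ^ N) := by gcongr; norm_num
    _ = r₀ := by field_simp
  have hfar : ∀ i j, i ≠ j →
      4 * R < dist (t.equivFin.symm i : EuclideanSpace ℝ (Fin m)) (t.equivFin.symm j) :=
    fun i j hij => hsep _ (t.equivFin.symm i).2 _ (t.equivFin.symm j).2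
      fun h => hij (t.equivFin.symm.injective (Subtype.ext h))
  refine ⟨t.card, fun i => t.equivFin.symm i, fun _ => R, ht.card_pos,
    (Finset.card_le_card hts).trans hcard, fun _ => ⟨hrR, hR₀⟩, fun i j hij => ?_, fun n => ?_,
    fun i j hij _ => by linarith [hfar i j hij]⟩
  · exact ball_disjoint_ball (by linarith [hfar i j hij])
  · obtain ⟨p, hp, hxp⟩ := hcov (x n) (mem_range_self n)
    exact ⟨t.equivFin ⟨p, hp⟩, by simpa using hxp⟩
end

section
/- Let d, d_L ∈ ℕ, let C ≥ 1, c ∈ (0,1), r ∈ (0,∞), let L ⊆ ℝ^{d×d} be a nonempty set, and let Ψ : (−r,r)^{d_L} → L be a surjective map with |Ψ(γ₁) − Ψ(γ₂)| ≤ C |γ₁ − γ₂| for all γ₁, γ₂ ∈ (−r,r)^{d_L}. Assume that for every Q ∈ L there exists a right inverse Ξ_Q : B_{cr}(Q) ∩ L → (−r,r)^{d_L} of Ψ (i.e. Ψ(Ξ_Q(Q')) = Q' for all Q' ∈ B_{cr}(Q) ∩ L) satisfying |Ξ_Q(Q₁) − Ξ_Q(Q₂)| ≤ C |Q₁ − Q₂|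 for all Q₁, Q₂ ∈ B_{cr}(Q) ∩ L. Then for every N ∈ ℕ and every subset ℛ ⊆ L with at most N elements there exists a map γ : ℛ → (−r,r)^{d_L} such that Ψ(γ(Q)) = Q for every Q ∈ ℛ, and |γ(Q₁) − γ(Q₂)| ≤ max{C, 2√(d_L) · 8^N / c} · |Q₁ − Q₂| for all Q₁, Q₂ ∈ ℛ. -/
open Set

/-- Dividing a finite set of at most `N` points into its `δ`-chain components: the
representatives are at distance at most `N * δ`, and distinct components are `δ`-separated. -/
theorem Set.Finite.exists_chain_component_representative {X : Type*} [PseudoMetricSpace X]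
    {s : Set X} (hs : s.Finite) {N : ℕ} (hN : s.ncard ≤ N) {δ : ℝ} (hδ : 0 ≤ δ) :
    ∃ ρ : X → X, (∀ x ∈ s, ρ x ∈ s ∧ dist x (ρ x) ≤ N * δ) ∧
      ∀ x ∈ s, ∀ y ∈ s, ρ x ≠ ρ y → δ ≤ dist x y := by
  classical
  have : Fintype s := hs.fintype
  let G : SimpleGraph s := SimpleGraph.fromRel fun x y => dist (x : X) y < δ
  have hwalk : ∀ {x y : s} (p : G.Walk x y), dist (x : X) y ≤ p.length * δ := by
    intro x y p
    induction p with
    | nil => simp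
    | @cons u v w h p ih =>
      have huv : dist (u : X) v < δ := by
        obtain ⟨-, h | h⟩ := (SimpleGraph.fromRel_adj _ _ _).1 h
        · exact h
        · rwa [dist_comm]
      have := dist_triangle (u : X) v w
      rw [SimpleGraph.Walk.length_cons]
      push_cast
      linarith
  let R : s → s := fun x => (G.connectedComponentMk x).out
  have hR : ∀ x, G.Reachable x (R x) := fun x =>
    SimpleGraph.ConnectedComponent.exact (Quot.out_eq (G.connectedComponentMk x)).symm
  refine ⟨fun x => if h : x ∈ s then R ⟨x, h⟩ else x, fun x hx => ?_, fun x hx y hy hne => ?_⟩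
  · simp only [hx, dif_pos]
    refine ⟨Subtype.coe_prop _, ?_⟩
    obtain ⟨p, hp⟩ := (hR ⟨x, hx⟩).exists_isPath
    have hlen : p.length ≤ N := by
      have := hp.length_lt
      rw [← Nat.card_eq_fintype_card, Nat.card_coe_set_eq] at this
      omega
    exact (hwalk p).trans (by gcongr)
  · by_contra! hlt
    apply hne
    simp only [hx, hy, dif_pos, R]
    by_cases hxy : x = y
    · subst hxy
      rfl
    · have hadj : G.Adj ⟨x, hx⟩ ⟨y, hy⟩ :=
        (SimpleGraph.fromRel_adj _ _ _).2 ⟨fun h => hxy (congrArg Subtype.val h), Or.inl hlt⟩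
      rw [SimpleGraph.ConnectedComponent.sound hadj.reachable]

theorem EuclideanSpace.norm_sub_le_of_mem_Ioo {n : ℕ} {r : ℝ}
    {x y : EuclideanSpace ℝ (Fin n)} (hx : ∀ i, x i ∈ Ioo (-r) r) (hy : ∀ i, y i ∈ Ioo (-r) r) :
    ‖x - y‖ ≤ 2 * Real.sqrt n * |r| := by
  rw [EuclideanSpace.norm_eq]
  refine Real.sqrt_le_iff.2 ⟨by positivity, ?_⟩
  have hle : ∀ i ∈ Finset.univ, ‖(x - y) i‖ ^ 2 ≤ (2 * r) ^ 2 := by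
    intro i _
    rw [Real.norm_eq_abs, sq_abs, PiLp.sub_apply]
    obtain ⟨h₁, h₂⟩ := hx i
    obtain ⟨h₃, h₄⟩ := hy i
    nlinarith
  refine (Finset.sum_le_card_nsmul _ _ _ hle).trans (le_of_eq ?_)
  simp only [Finset.card_univ, Fintype.card_fin, nsmul_eq_mul, mul_pow, sq_abs]
  rw [Real.sq_sqrt (Nat.cast_nonneg n)]
  ring

/-- Step 1 of the proof of Lemma 4.1: if `L ⊆ ℝ^{d×d}` admits a locally
Bilipschitz parametrization `Ψ : (-r,r)^{d_L} → L` (Lipschitz with constant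
`C ≥ 1`, with local Lipschitz right inverses on balls `B_{cr}(Q) ∩ L`,
`Q ∈ L`), then every subset `ℛ ⊆ L` with at most `N` elements can be lifted:
there is `γ : ℛ → (-r,r)^{d_L}` with `Ψ ∘ γ = id` on `ℛ` which is Lipschitz
with constant `max{C, 2 √(d_L) 8^N / c}`. -/
theorem finite_subset_lipschitz_lift
    (d dL : ℕ) (C c r : ℝ) (hC : 1 ≤ C) (hc : c ∈ Ioo (0 : ℝ) 1) (hr : 0 < r)
    (L : Set (Matrix (Fin d) (Fin d) ℝ)) (hL : L.Nonempty)
    (Ψ : EuclideanSpace ℝ (Fin dL) → Matrix (Fin d) (Fin d) ℝ)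
    (hΨmem : ∀ γ : EuclideanSpace ℝ (Fin dL), (∀ i, γ i ∈ Ioo (-r) r) → Ψ γ ∈ L)
    (hΨsurj : ∀ Q ∈ L, ∃ γ : EuclideanSpace ℝ (Fin dL),
      (∀ i, γ i ∈ Ioo (-r) r) ∧ Ψ γ = Q)
    (hΨlip : ∀ γ₁ γ₂ : EuclideanSpace ℝ (Fin dL), (∀ i, γ₁ i ∈ Ioo (-r) r) →
      (∀ i, γ₂ i ∈ Ioo (-r) r) → frobNorm (Ψ γ₁ - Ψ γ₂) ≤ C * ‖γ₁ - γ₂‖)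
    (hΨinv : ∀ Q ∈ L, ∃ Ξ : Matrix (Fin d) (Fin d) ℝ → EuclideanSpace ℝ (Fin dL),
      (∀ Q' ∈ L, frobNorm (Q' - Q) < c * r →
        (∀ i, Ξ Q' i ∈ Ioo (-r) r) ∧ Ψ (Ξ Q') = Q') ∧
      (∀ Q₁ ∈ L, frobNorm (Q₁ - Q) < c * r →
        ∀ Q₂ ∈ L, frobNorm (Q₂ - Q) < c * r →
          ‖Ξ Q₁ - Ξ Q₂‖ ≤ C * frobNorm (Q₁ - Q₂))) :
    ∀ (N : ℕ) (ℛ : Set (Matrix (Fin d) (Fin d) ℝ)), ℛ ⊆ L → ℛ.Finite →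
      ℛ.ncard ≤ N →
      ∃ γ : Matrix (Fin d) (Fin d) ℝ → EuclideanSpace ℝ (Fin dL),
        (∀ Q ∈ ℛ, (∀ i, γ Q i ∈ Ioo (-r) r) ∧ Ψ (γ Q) = Q) ∧
        (∀ Q₁ ∈ ℛ, ∀ Q₂ ∈ ℛ,
          ‖γ Q₁ - γ Q₂‖ ≤
            max C (2 * Real.sqrt dL * 8 ^ N / c) * frobNorm (Q₁ - Q₂)) := by
  intro N ℛ hℛL hfin hcard
  obtain ⟨hc₀, -⟩ := hc
  let _ : SeminormedAddCommGroup (Matrix (Fin d) (Fin d) ℝ) :=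
    Matrix.frobeniusSeminormedAddCommGroup
  have hnorm : ∀ A B : Matrix (Fin d) (Fin d) ℝ, frobNorm (A - B) = dist A B := by
    intro A B
    rw [dist_eq_norm, Matrix.frobenius_norm_def, frobNorm, Real.sqrt_eq_rpow]
    simp
  simp only [hnorm] at *
  have hδ : 0 < c * r / 8 ^ N := by positivity
  obtain ⟨ρ, hρ, hsep⟩ := hfin.exists_chain_component_representative hcard hδ.le
  choose! Ξ hΞ hΞlip using hΨinv
  have hnear : ∀ Q ∈ ℛ, dist Q (ρ Q) < c * r := by
    intro Q hQ
    refine (hρ Q hQ).2.trans_lt ?_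
    have hN : (N : ℝ) < 8 ^ N := by exact_mod_cast Nat.lt_pow_self (by norm_num : 1 < 8)
    rw [mul_div_assoc', div_lt_iff₀ (by positivity), mul_comm]
    exact mul_lt_mul_of_pos_left hN (by positivity)
  have hlift : ∀ Q ∈ ℛ, (∀ i, Ξ (ρ Q) Q i ∈ Ioo (-r) r) ∧ Ψ (Ξ (ρ Q) Q) = Q :=
    fun Q hQ => hΞ _ (hℛL (hρ Q hQ).1) Q (hℛL hQ) (hnear Q hQ)
  refine ⟨fun Q => Ξ (ρ Q) Q, hlift, fun Q₁ h₁ Q₂ h₂ => ?_⟩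
  by_cases heq : ρ Q₁ = ρ Q₂
  · have hlip := hΞlip _ (hℛL (hρ Q₁ h₁).1) Q₁ (hℛL h₁) (hnear Q₁ h₁) Q₂ (hℛL h₂)
      (heq ▸ hnear Q₂ h₂)
    simp only [← heq]
    exact hlip.trans (mul_le_mul_of_nonneg_right (le_max_left _ _) dist_nonneg)
  · calc ‖Ξ (ρ Q₁) Q₁ - Ξ (ρ Q₂) Q₂‖ ≤ 2 * Real.sqrt dL * |r| :=
          EuclideanSpace.norm_sub_le_of_mem_Ioo (hlift Q₁ h₁).1 (hlift Q₂ h₂).1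
      _ = 2 * Real.sqrt dL * 8 ^ N / c * (c * r / 8 ^ N) := by
          rw [abs_of_pos hr]
          field_simp
      _ ≤ max C (2 * Real.sqrt dL * 8 ^ N / c) * dist Q₁ Q₂ := by
          gcongr
          · exact le_max_right _ _
          · exact hsep Q₁ h₁ Q₂ h₂ heq
end

section
/- Let d ≥ 1 and let R₁, R₂ ∈ SO(d) with R₁ ≠ R₂. Then rank(R₁ − R₂) ≥ 2; that is, no two distinct rotations differ by a matrix of rank one (they satisfy no rank-one connection / Hadamard compatibility condition). -/
namespace Matrix

variable {m n K : Type*} [Fintype n] [Field K]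

/-- A matrix of rank at most one is an outer product. -/
theorem exists_eq_vecMulVec_of_rank_le_one {A : Matrix m n K} (h : A.rank ≤ 1) :
    ∃ (u : m → K) (v : n → K), A = vecMulVec u v := by
  classical
  obtain ⟨u, hu⟩ := finrank_le_one_iff.mp h
  choose c hc using fun j => hu ⟨A.mulVecLin (Pi.single j 1), LinearMap.mem_range_self _ _⟩
  refine ⟨u, c, ?_⟩
  ext i j
  have := congrFun (congrArg Subtype.val (hc j)) i
  simpa [vecMulVec_apply, mul_comm] using this.symm

/-- An orthogonal matrix of determinant one that differs from the identity by a matrix of rank at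
most one is the identity. -/
theorem eq_one_of_transpose_mul_self_of_rank_sub_one_le [DecidableEq n] {Q : Matrix n n ℝ}
    (hQ : Qᵀ * Q = 1) (hdet : Q.det = 1) (hrank : (Q - 1).rank ≤ 1) : Q = 1 := by
  obtain ⟨u, v, huv⟩ := exists_eq_vecMulVec_of_rank_le_one hrank
  have htr : (Q - 1).trace = 0 := by
    have hd : (1 + vecMulVec u v).det = 1 := by rw [← huv, add_sub_cancel, hdet]
    rw [vecMulVec_eq Unit, det_one_add_replicateCol_mul_replicateRow] at hd
    rw [huv, trace_vecMulVec, dotProduct_comm]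
    linarith
  have hsq : (Q - 1)ᵀ * (Q - 1) = -((Q - 1) + (Q - 1)ᵀ) := by
    simp only [transpose_sub, transpose_one, sub_mul, mul_sub, hQ, one_mul, mul_one]
    abel
  have hzero : ((Q - 1)ᴴ * (Q - 1)).trace = 0 := by
    rw [conjTranspose_eq_transpose_of_trivial, hsq, trace_neg, trace_add, trace_transpose, htr]
    simp
  exact sub_eq_zero.mp (trace_conjTranspose_mul_self_eq_zero_iff.mp hzero)

end Matrix


/-- Two distinct rotations do not satisfy the Hadamard compatibility
condition: if `R₁, R₂ ∈ SO(d)` (i.e. `Rᵢᵀ Rᵢ = I` and `det Rᵢ = 1`) with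
`R₁ ≠ R₂`, then `rank(R₁ - R₂) ≥ 2`; that is, no two distinct rotations are
rank-one connected. -/
theorem rotations_rank_ge_two
    (d : ℕ) (hd : 1 ≤ d)
    (R₁ R₂ : Matrix (Fin d) (Fin d) ℝ)
    (h₁ : R₁.transpose * R₁ = 1 ∧ R₁.det = 1)
    (h₂ : R₂.transpose * R₂ = 1 ∧ R₂.det = 1)
    (hne : R₁ ≠ R₂) :
    2 ≤ (R₁ - R₂).rank := by
  by_contra! hlt
  have hright : R₂ * R₂.transpose = 1 := mul_eq_one_comm.mp h₂.1
  have hQ : R₂.transpose * R₁ = 1 := by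
    apply Matrix.eq_one_of_transpose_mul_self_of_rank_sub_one_le
    · rw [Matrix.transpose_mul, Matrix.transpose_transpose, Matrix.mul_assoc,
        ← Matrix.mul_assoc R₂, hright, Matrix.one_mul, h₁.1]
    · rw [Matrix.det_mul, Matrix.det_transpose, h₁.2, h₂.2, one_mul]
    · rw [← h₂.1, ← Matrix.mul_sub]
      exact (Matrix.rank_mul_le_right _ _).trans (Nat.le_of_lt_succ hlt)
  apply hne
  rw [← Matrix.one_mul R₁, ← hright, Matrix.mul_assoc, hQ, Matrix.mul_one]
end
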